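/- The operator δ'(u) = e^α·(δ(u) − u) satisfies δ'(1) = 0 and δ' ∘ δ' = δ', i.e. δ'(δ'(u)) = δ'(u) for all u ∈ ℤ[M]. -/

import Mathlib

open AddMonoidAlgebra

noncomputable section

/-- The reflection `λ ↦ λ - c(λ) • α` associated to a root `α` and coroot `c`,
as an additive homomorphism of the weight lattice `M`. -/
def demazureReflection {M : Type*} [AddCommGroup M] (α : M) (c : M →+ ℤ) : M →+ M where
  toFun := fun lam => lam - c lam • α
  map_zero' := by simp
  map_add' := fun x y => by simp only [map_add, add_smul]; abel

/-- The ring endomorphism of the group algebra `ℤ[M]` induced by the reflection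
`s(λ) = λ - c(λ)·α`; it sends `e^λ` to `e^{s(λ)}`. -/
def demazureReflectionAlg {M : Type*} [AddCommGroup M] (α : M) (c : M →+ ℤ) :
    AddMonoidAlgebra ℤ M →+* AddMonoidAlgebra ℤ M :=
  mapDomainRingHom ℤ (demazureReflection α c)
theorem demazureReflection_involutive {M : Type*} [AddCommGroup M] (α : M) (c : M →+ ℤ)
    (hc : c α = 2) : Function.Involutive (demazureReflection α c) := by
  intro x
  simp only [demazureReflection, AddMonoidHom.coe_mk, ZeroHom.coe_mk, map_sub, map_zsmul, hc]
  module

theorem demazureReflectionAlg_single {M : Type*} [AddCommGroup M] (α : M) (c : M →+ ℤ)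
    (m : M) (n : ℤ) :
    demazureReflectionAlg α c (single m n) = single (demazureReflection α c m) n := by
  simp [demazureReflectionAlg]

theorem demazureReflectionAlg_involutive {M : Type*} [AddCommGroup M] (α : M) (c : M →+ ℤ)
    (hc : c α = 2) : Function.Involutive (demazureReflectionAlg α c) := by
  intro u
  induction u using AddMonoidAlgebra.induction_linear with
  | zero => simp
  | add f g hf hg => simp [hf, hg]
  | single m n =>
    rw [demazureReflectionAlg_single, demazureReflectionAlg_single,
      demazureReflection_involutive α c hc m]

/-- δ'(1) = 0 and δ' ∘ δ' = δ', where δ'(u) = e^α (δ(u) - u). -/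
theorem demazure_prime_zero_and_idempotent {M : Type*} [AddCommGroup M]
    [Module.Free ℤ M] [Module.Finite ℤ M]
    (α : M) (hα : α ≠ 0) (c : M →+ ℤ) (hc : c α = 2)
    (δ : AddMonoidAlgebra ℤ M →ₗ[ℤ] AddMonoidAlgebra ℤ M)
    (hδ : ∀ u : AddMonoidAlgebra ℤ M,
      (1 - single (-α) 1) * δ u = u - single (-α) 1 * demazureReflectionAlg α c u) :
    single α 1 * (δ 1 - 1) = 0 ∧
    ∀ u : AddMonoidAlgebra ℤ M,
      single α 1 * (δ (single α 1 * (δ u - u)) - single α 1 * (δ u - u)) =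
        single α 1 * (δ u - u) := by
  have : UniqueSums M := UniqueSums.of_injective_addHom
    (Module.Free.chooseBasis ℤ M).repr.toAddEquiv.toAddMonoidHom.toAddHom
    (Module.Free.chooseBasis ℤ M).repr.injective inferInstance
  have : IsCancelMulZero (AddMonoidAlgebra ℤ M) := NoZeroDivisors.toIsCancelMulZero
  have hd : (1 - single (-α) 1 : AddMonoidAlgebra ℤ M) ≠ 0 := by
    rw [sub_ne_zero, one_def]
    intro h
    rw [AddMonoidAlgebra.single_left_inj one_ne_zero] at h
    exact hα (by simpa using h.symm)
  have hxy : (single (-α) 1 : AddMonoidAlgebra ℤ M) * single α 1 = 1 := by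
    simp [single_mul_single, one_def]
  have hsx : demazureReflectionAlg α c (single (-α) 1) = single α 1 := by
    rw [demazureReflectionAlg_single]
    congr 1
    simp only [demazureReflection, AddMonoidHom.coe_mk, ZeroHom.coe_mk, map_neg, hc]
    module
  have hss := demazureReflectionAlg_involutive α c hc
  generalize (single (-α) 1 : AddMonoidAlgebra ℤ M) = x at *
  generalize (single α 1 : AddMonoidAlgebra ℤ M) = y at *
  generalize demazureReflectionAlg α c = s at *
  constructor
  · have h1 : δ 1 = 1 := mul_left_cancel₀ hd (by rw [hδ, map_one]; ring)
    rw [h1, sub_self, mul_zero]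
  · intro u
    obtain ⟨v, hv⟩ : ∃ v, v = y * (δ u - u) := ⟨_, rfl⟩
    rw [← hv]
    have hdv : (1 - x) * v = u - s u := by
      linear_combination (1 - x) * hv + y * hδ u + (u - s u) * hxy
    have hsdv : (1 - y) * s v = s u - u := by
      have := congrArg s hdv
      rwa [map_mul, map_sub, map_sub, map_one, hsx, hss u] at this
    have hsv : s v = x * v := mul_left_cancel₀ hd (by
      linear_combination -x * hsdv - x * hdv - s v * hxy)
    have hδv : δ v = v + x * v := mul_left_cancel₀ hd (by
      rw [hδ, hsv]
      ring)
    rw [hδv]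
    linear_combination v * hxy
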